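/- arXiv:1804.09393 — 2 statements merged into one kernel-verified Lean document; each statement's English description precedes it below -/
import Mathlib

section
/- If μ(t+1) = μ(t) for some natural number t, then μ(t+3) = μ(t+2). -/
open scoped Classical

/-- The degree of a vertex `v` under an edge-weight assignment `x`:
the sum of the weights of the edges of `G` incident to `v`. -/
noncomputable def bmDeg {V : Type*} [Fintype V] (G : SimpleGraph V)
    (x : Sym2 V → ℕ) (v : V) : ℕ :=
  ∑ e ∈ Finset.univ.filter (fun e : Sym2 V => e ∈ G.edgeSet ∧ v ∈ e), x e

/-- The cardinality `‖x‖₁` of an edge-weight assignment `x`. -/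
noncomputable def bmCard {V : Type*} [Fintype V] (G : SimpleGraph V)
    (x : Sym2 V → ℕ) : ℕ :=
  ∑ e ∈ Finset.univ.filter (fun e : Sym2 V => e ∈ G.edgeSet), x e

/-- `x` is a `b`-matching of `(G, b)`: it is supported on the edges of `G`
and the degree of every vertex `v` is at most `b v`. -/
def IsBMatching {V : Type*} [Fintype V] (G : SimpleGraph V) (b : V → ℕ)
    (x : Sym2 V → ℕ) : Prop :=
  (∀ e, e ∉ G.edgeSet → x e = 0) ∧ ∀ v, bmDeg G x v ≤ b v

/-- The maximum cardinality of a `b`-matching of `(G, b)`. -/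
noncomputable def maxBM {V : Type*} [Fintype V] (G : SimpleGraph V) (b : V → ℕ) : ℕ :=
  sSup {m | ∃ x, IsBMatching G b x ∧ bmCard G x = m}

/-- `mu G b w t` : the maximum cardinality of a `b`-matching of `G` when the
capacity of `w` is set to `t` and every other vertex `v` has capacity `b v`. -/
noncomputable def mu {V : Type*} [Fintype V] (G : SimpleGraph V) (b : V → ℕ)
    (w : V) (t : ℕ) : ℕ :=
  maxBM G (Function.update b w t)



/-- Integer-valued degree. -/
noncomputable def dgZ {V : Type*} [Fintype V] (G : SimpleGraph V)
    (d : Sym2 V → ℤ) (v : V) : ℤ :=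
  ∑ e ∈ Finset.univ.filter (fun e : Sym2 V => e ∈ G.edgeSet ∧ v ∈ e), d e

/-- Integer-valued cardinality. -/
noncomputable def cdZ {V : Type*} [Fintype V] (G : SimpleGraph V)
    (d : Sym2 V → ℤ) : ℤ :=
  ∑ e ∈ Finset.univ.filter (fun e : Sym2 V => e ∈ G.edgeSet), d e

lemma dgZ_add {V : Type*} [Fintype V] (G : SimpleGraph V) (d f : Sym2 V → ℤ) (v : V) :
    dgZ G (fun e => d e + f e) v = dgZ G d v + dgZ G f v := by
  simp [dgZ, Finset.sum_add_distrib]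

lemma dgZ_sub {V : Type*} [Fintype V] (G : SimpleGraph V) (d f : Sym2 V → ℤ) (v : V) :
    dgZ G (fun e => d e - f e) v = dgZ G d v - dgZ G f v := by
  simp [dgZ, Finset.sum_sub_distrib]

lemma cdZ_add {V : Type*} [Fintype V] (G : SimpleGraph V) (d f : Sym2 V → ℤ) :
    cdZ G (fun e => d e + f e) = cdZ G d + cdZ G f := by
  simp [cdZ, Finset.sum_add_distrib]

lemma cdZ_sub {V : Type*} [Fintype V] (G : SimpleGraph V) (d f : Sym2 V → ℤ) :
    cdZ G (fun e => d e - f e) = cdZ G d - cdZ G f := by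
  simp [cdZ, Finset.sum_sub_distrib]

lemma dgZ_single {V : Type*} [Fintype V] (G : SimpleGraph V) (e : Sym2 V)
    (he : e ∈ G.edgeSet) (c : ℤ) (v : V) :
    dgZ G (fun a => if a = e then c else 0) v = if v ∈ e then c else 0 := by
  simp [dgZ, Finset.sum_ite_eq', he]

lemma cdZ_single {V : Type*} [Fintype V] (G : SimpleGraph V) (e : Sym2 V)
    (he : e ∈ G.edgeSet) (c : ℤ) :
    cdZ G (fun a => if a = e then c else 0) = c := by
  simp [cdZ, Finset.sum_ite_eq', he]

lemma dgZ_cast {V : Type*} [Fintype V] (G : SimpleGraph V) (x : Sym2 V → ℕ) (v : V) :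
    dgZ G (fun e => (x e : ℤ)) v = bmDeg G x v := by
  simp [dgZ, bmDeg]

lemma cdZ_cast {V : Type*} [Fintype V] (G : SimpleGraph V) (x : Sym2 V → ℕ) :
    cdZ G (fun e => (x e : ℤ)) = bmCard G x := by
  simp [cdZ, bmCard]

lemma bm_bdd {V : Type*} [Fintype V] (G : SimpleGraph V) (b : V → ℕ) :
    BddAbove {m | ∃ x, IsBMatching G b x ∧ bmCard G x = m} := by
  refine ⟨∑ e ∈ Finset.univ.filter (fun e : Sym2 V => e ∈ G.edgeSet), ∑ v, b v, ?_⟩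
  rintro m ⟨x, hx, rfl⟩
  apply Finset.sum_le_sum
  intro e he
  have he' : e ∈ G.edgeSet := by simpa using he
  obtain ⟨v, hv⟩ : ∃ v, v ∈ e := ⟨e.out.1, Sym2.out_fst_mem e⟩
  calc x e ≤ bmDeg G x v :=
        Finset.single_le_sum (f := x) (fun _ _ => Nat.zero_le _) (by simp [he', hv])
    _ ≤ b v := hx.2 v
    _ ≤ ∑ v, b v := Finset.single_le_sum (f := b) (fun _ _ => Nat.zero_le _) (Finset.mem_univ v)

lemma bm_exists {V : Type*} [Fintype V] (G : SimpleGraph V) (b : V → ℕ) :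
    ∃ x, IsBMatching G b x ∧ bmCard G x = maxBM G b := by
  have := Nat.sSup_mem (s := {m | ∃ x, IsBMatching G b x ∧ bmCard G x = m})
    ⟨0, fun _ => 0, ⟨by simp, by simp [bmDeg]⟩, by simp [bmCard]⟩ (bm_bdd G b)
  exact this

lemma bm_le {V : Type*} [Fintype V] (G : SimpleGraph V) (b : V → ℕ) (x : Sym2 V → ℕ)
    (hx : IsBMatching G b x) : bmCard G x ≤ maxBM G b :=
  le_csSup (bm_bdd G b) ⟨x, hx, rfl⟩

lemma bm_leZ {V : Type*} [Fintype V] (G : SimpleGraph V) (b : V → ℕ) (w : V) (t : ℕ)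
    (z : Sym2 V → ℤ) (h0 : ∀ e, 0 ≤ z e) (hs : ∀ e, e ∉ G.edgeSet → z e = 0)
    (hd : ∀ v, v ≠ w → dgZ G z v ≤ b v) (hw : dgZ G z w ≤ t) :
    cdZ G z ≤ mu G b w t := by
  have hz : z = fun e => (((z e).toNat : ℕ) : ℤ) := by
    funext e; simp [h0 e]
  rw [hz] at hw hd ⊢
  rw [cdZ_cast]
  rw [dgZ_cast] at hw
  have : IsBMatching G (Function.update b w t) (fun e => (z e).toNat) := by
    refine ⟨fun e he => by simp [hs e he], fun v => ?_⟩
    by_cases hv : v = w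
    · subst hv; simpa using hw
    · have := hd v hv
      rw [dgZ_cast] at this
      simpa [hv] using this
  exact_mod_cast bm_le G _ _ this

/-- A partial alternating structure between `0` and `D`. -/
def AltState {V : Type*} [Fintype V] (G : SimpleGraph V) (w : V) (D d : Sym2 V → ℤ)
    (v : V) (ε : ℤ) : Prop :=
  (ε = 1 ∨ ε = -1) ∧ (∀ e, (0 ≤ d e ∧ d e ≤ D e) ∨ (D e ≤ d e ∧ d e ≤ 0)) ∧
  (∀ u, dgZ G d u = (if u = w then 1 else 0) + (if u = v then ε else 0)) ∧
  2 * cdZ G d = 1 + ε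

lemma altState_exists {V : Type*} [Fintype V] (G : SimpleGraph V) (w : V) (D : Sym2 V → ℤ) :
    ∃ d v ε, AltState G w D d v ε ∧ ∀ e ∈ G.edgeSet, v ∈ e → 0 ≤ ε * (D e - d e) := by
  have hne : ∃ n : ℕ, ∃ d v ε, AltState G w D d v ε ∧ ∑ e, (D e - d e).natAbs = n := by
    refine ⟨_, fun _ => 0, w, -1, ⟨Or.inr rfl, ?_, ?_, ?_⟩, rfl⟩
    · intro e; simp only [le_refl, true_and, and_true]; exact le_total _ _
    · intro u; by_cases h : u = w <;> simp [dgZ, h]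
    · simp [cdZ]
  obtain ⟨d, v, ε, hS, hn⟩ := Nat.find_spec hne
  refine ⟨d, v, ε, hS, ?_⟩
  intro e he hv
  by_contra hlt
  push Not at hlt
  obtain ⟨u, rfl⟩ := hv
  have huv : v ≠ u := G.ne_of_adj he
  obtain ⟨hε, hc, hdg, hcd⟩ := hS
  let d' : Sym2 V → ℤ := fun a => d a - (if a = s(v, u) then ε else 0)
  have hlt' : ∑ e, (D e - d' e).natAbs < Nat.find hne := by
    rw [← hn]
    have key := hc s(v, u)
    apply Finset.sum_lt_sum
    · intro a _
      by_cases ha : a = s(v, u)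
      · subst ha
        simp only [d', if_true]
        rcases hε with rfl | rfl <;> omega
      · simp [d', ha]
    · refine ⟨s(v, u), Finset.mem_univ _, ?_⟩
      simp only [d', if_true]
      rcases hε with rfl | rfl <;> omega
  refine Nat.find_min hne hlt' ⟨d', u, -ε, ⟨?_, ?_, ?_, ?_⟩, rfl⟩
  · rcases hε with rfl | rfl <;> simp
  · intro a
    by_cases ha : a = s(v, u)
    · subst ha
      have key := hc s(v, u)
      simp only [d', if_true]
      rcases hε with rfl | rfl <;> omega
    · simpa [d', ha] using hc a
  · intro a
    have h1 : dgZ G d' a = _ := dgZ_sub G d _ a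
    rw [h1, dgZ_single G _ he, hdg]
    simp only [Sym2.mem_iff]
    by_cases h2 : a = v
    · subst h2; simp [huv]
    · simp [h2]; split_ifs <;> ring
  · have h1 : cdZ G d' = _ := cdZ_sub G d _
    rw [h1, cdZ_single G _ he]
    linarith

/-- If `μ(t+1) = μ(t)` then `μ(t+3) = μ(t+2)`. -/
theorem mu_after_plateau {V : Type*} [Fintype V] (G : SimpleGraph V) (b : V → ℕ)
    (w : V) (t : ℕ) (h : mu G b w (t + 1) = mu G b w t) :
    mu G b w (t + 3) = mu G b w (t + 2) := by
  obtain ⟨x, ⟨hx0, hxd⟩, hxc⟩ := bm_exists G (Function.update b w (t + 3))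
  obtain ⟨y, ⟨hy0, hyd⟩, hyc⟩ := bm_exists G (Function.update b w t)
  obtain ⟨z, ⟨hz0, hzd⟩, hzc⟩ := bm_exists G (Function.update b w (t + 2))
  change _ = mu G b w (t + 3) at hxc
  change _ = mu G b w t at hyc
  change _ = mu G b w (t + 2) at hzc
  have split : ∀ (s : ℕ) (x : Sym2 V → ℕ), (∀ v, bmDeg G x v ≤ Function.update b w s v) →
      (∀ v, v ≠ w → dgZ G (fun e => (x e : ℤ)) v ≤ b v) ∧
        dgZ G (fun e => (x e : ℤ)) w ≤ s := by
    intro s x hx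
    refine ⟨fun v hv => ?_, ?_⟩
    · have := hx v
      simp only [dgZ_cast]
      simpa [hv] using this
    · have := hx w
      simp only [dgZ_cast]
      simpa using this
  obtain ⟨hxd, hxw⟩ := split _ _ hxd
  obtain ⟨hyd, hyw⟩ := split _ _ hyd
  obtain ⟨hzd, hzw⟩ := split _ _ hzd
  have hxc' : cdZ G (fun e => (x e : ℤ)) = mu G b w (t + 3) := by rw [cdZ_cast, hxc]
  have hyc' : cdZ G (fun e => (y e : ℤ)) = mu G b w t := by rw [cdZ_cast, hyc]
  have hzc' : cdZ G (fun e => (z e : ℤ)) = mu G b w (t + 2) := by rw [cdZ_cast, hzc]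
  have hmono := bm_leZ G b w (t + 3) (fun e => (z e : ℤ)) (fun e => by simp)
    (fun e he => by simp [hz0 e he]) hzd (by push_cast at hzw ⊢; linarith)
  by_contra hne
  have hgt : mu G b w (t + 2) + 1 ≤ mu G b w (t + 3) := by
    rw [hzc'] at hmono; omega
  have hxw3 : dgZ G (fun e => (x e : ℤ)) w = t + 3 := by
    by_contra hh
    have := bm_leZ G b w (t + 2) (fun e => (x e : ℤ)) (fun e => by simp)
      (fun e he => by simp [hx0 e he]) hxd (by push_cast at hxw ⊢; omega)
    omega
  obtain ⟨d, v, ε, ⟨hε, hc, hdg, hcd⟩, hmax⟩ :=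
    altState_exists G w (fun e => (x e : ℤ) - (y e : ℤ))
  have hds : ∀ e, e ∉ G.edgeSet → d e = 0 := by
    intro e he
    have := hc e
    simp only [hx0 e he, hy0 e he] at this
    omega
  have hsum : 0 ≤ ε * (dgZ G (fun e => (x e : ℤ)) v - dgZ G (fun e => (y e : ℤ)) v
      - dgZ G d v) := by
    rw [← dgZ_sub, ← dgZ_sub, dgZ, Finset.mul_sum]
    apply Finset.sum_nonneg
    intro e he
    simp only [Finset.mem_filter, Finset.mem_univ, true_and] at he
    exact hmax e he.1 he.2
  -- the two exchanged matchings
  have hY := fun s hd hw => bm_leZ G b w s (fun e => (y e : ℤ) + d e)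
    (fun e => by have := hc e; beta_reduce at this; omega) (fun e he => by simp [hy0 e he, hds e he]) hd hw
  have hX := fun s hd hw => bm_leZ G b w s (fun e => (x e : ℤ) - d e)
    (fun e => by have := hc e; beta_reduce at this; omega) (fun e he => by simp [hx0 e he, hds e he]) hd hw
  simp only [dgZ_add, dgZ_sub, cdZ_add, cdZ_sub, hxc', hyc'] at hX hY
  by_cases hvw : v = w
  · subst hvw
    have hdw := hdg v
    simp only [if_true] at hdw
    have hoff : ∀ u, u ≠ v → dgZ G d u = 0 := fun u hu => by rw [hdg u]; simp [hu]
    rcases hε with rfl | rfl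
    · have h1 := hY (t + 2) (fun u hu => by rw [hoff u hu]; simpa using hyd u hu)
        (by push_cast; linarith)
      have h2 := hX (t + 1) (fun u hu => by rw [hoff u hu]; simpa using hxd u hu)
        (by push_cast; linarith)
      omega
    · linarith
  · have hdv := hdg v
    have hdw := hdg w
    simp only [if_true, hvw, if_false, Ne.symm hvw] at hdv hdw
    have hoff : ∀ u, u ≠ w → u ≠ v → dgZ G d u = 0 := fun u hu hu' => by
      rw [hdg u]; simp [hu, hu']
    have hxv := hxd v hvw
    have hyv := hyd v hvw
    rcases hε with rfl | rfl
    · have h1 := hY (t + 1) (fun u hu => by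
        by_cases huv : u = v
        · subst huv; linarith
        · rw [hoff u hu huv]; simpa using hyd u hu) (by push_cast; linarith)
      omega
    · have h1 := hX (t + 2) (fun u hu => by
        by_cases huv : u = v
        · subst huv; linarith
        · rw [hoff u hu huv]; simpa using hxd u hu) (by push_cast; linarith)
      omega
end

section
/- Let t_max be the least natural number t₀ such that μ(t) = μ(t₀) for all t ≥ t₀, let c₁ be the largest natural number t such that μ(t) = μ(0) + t, and let c₂ = (t_max − c₁)/2. If t is a natural number such that either t ≤ c₁, or t = c₁ + 2j for some natural number j ≤ c₂, then every maximum-cardinality b-matching x of G with the capacity of w set to t saturates w, i.e. deg_x(w) = t. -/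
open scoped Classical

/-- `a` lies between `0` and `c`. -/
def Conf (a c : ℤ) : Prop := (0 ≤ a ∧ a ≤ c) ∨ (c ≤ a ∧ a ≤ 0)

noncomputable def degZ {V : Type*} [Fintype V] (G : SimpleGraph V)
    (D : Sym2 V → ℤ) (v : V) : ℤ :=
  ∑ e ∈ Finset.univ.filter (fun e : Sym2 V => e ∈ G.edgeSet ∧ v ∈ e), D e

noncomputable def cardZ {V : Type*} [Fintype V] (G : SimpleGraph V)
    (D : Sym2 V → ℤ) : ℤ :=
  ∑ e ∈ Finset.univ.filter (fun e : Sym2 V => e ∈ G.edgeSet), D e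

section aux
variable {V : Type*} [Fintype V] (G : SimpleGraph V)

lemma degZ_sub (D E : Sym2 V → ℤ) (v : V) : degZ G (D - E) v = degZ G D v - degZ G E v := by
  simp [degZ, Finset.sum_sub_distrib]

lemma degZ_add (D E : Sym2 V → ℤ) (v : V) : degZ G (D + E) v = degZ G D v + degZ G E v := by
  simp [degZ, Finset.sum_add_distrib]

lemma degZ_neg (D : Sym2 V → ℤ) (v : V) : degZ G (-D) v = - degZ G D v := by
  simp [degZ]

lemma cardZ_sub (D E : Sym2 V → ℤ) : cardZ G (D - E) = cardZ G D - cardZ G E := by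
  simp [cardZ, Finset.sum_sub_distrib]

lemma cardZ_add (D E : Sym2 V → ℤ) : cardZ G (D + E) = cardZ G D + cardZ G E := by
  simp [cardZ, Finset.sum_add_distrib]

lemma handshake (D : Sym2 V → ℤ) : ∑ v, degZ G D v = 2 * cardZ G D := by
  have h : ∀ v, degZ G D v =
      ∑ e ∈ Finset.univ.filter (fun e : Sym2 V => e ∈ G.edgeSet), if v ∈ e then D e else 0 := by
    intro v
    rw [← Finset.sum_filter, Finset.filter_filter]
    rfl
  simp_rw [h]
  rw [Finset.sum_comm, cardZ, Finset.mul_sum]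
  refine Finset.sum_congr rfl fun e he => ?_
  rw [Finset.mem_filter] at he
  have he := he.2
  rw [← Finset.sum_filter, Finset.sum_const]
  have : (Finset.univ.filter (fun v => v ∈ e)) = e.toFinset := by
    ext v; simp
  rw [this, Sym2.card_toFinset_of_not_isDiag e (G.not_isDiag_of_mem_edgeSet he)]
  simp

lemma degZ_single (e : Sym2 V) (he : e ∈ G.edgeSet) (v : V) :
    degZ G (Pi.single e 1) v = if v ∈ e then 1 else 0 := by
  unfold degZ
  simp [Pi.single_apply, he]

lemma exch (n : ℕ) : ∀ (D : Sym2 V → ℤ), ∑ e, (D e).natAbs ≤ n → ∀ u, 0 < degZ G D u →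
    ∃ (f : Sym2 V → ℤ) (v : V) (s : ℤ), (s = 1 ∨ s = -1) ∧ (∀ e, Conf (f e) (D e)) ∧
      (∀ z, Conf (degZ G f z) (degZ G D z)) ∧ 1 ≤ degZ G f u ∧
      ∀ z, degZ G f z = (if z = u then 1 else 0) + s * (if z = v then 1 else 0) := by
  induction n with
  | zero =>
    intro D hD u hu
    have : ∀ e, D e = 0 := by
      intro e
      have := Finset.single_le_sum (f := fun e => (D e).natAbs) (fun _ _ => Nat.zero_le _)
        (Finset.mem_univ e)
      omega
    simp [degZ, this] at hu
  | succ n ih =>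
    intro D hD u hu
    obtain ⟨e, he, hpos⟩ := Finset.exists_lt_of_sum_lt (f := fun _ => (0:ℤ)) (g := D)
      (by simpa [degZ] using hu)
    rw [Finset.mem_filter] at he
    obtain ⟨-, heG, hue⟩ := he
    obtain ⟨v, rfl⟩ := hue
    have huv : u ≠ v := G.ne_of_adj heG
    have hs : ∀ z, degZ G (Pi.single s(u, v) 1) z
        = (if z = u then 1 else 0) + (if z = v then 1 else 0) := by
      intro z
      rw [degZ_single G _ heG]
      by_cases h1 : z = u <;> by_cases h2 : z = v <;> simp_all
    have hse : ∀ e', (Pi.single s(u, v) 1 : Sym2 V → ℤ) e' = if e' = s(u, v) then 1 else 0 := by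
      intro e'; rw [Pi.single_apply]
    by_cases hv : 0 < degZ G D v
    · refine ⟨Pi.single s(u, v) 1, v, 1, Or.inl rfl, ?_, ?_, ?_, ?_⟩
      · intro e'
        rw [hse]
        unfold Conf
        split_ifs with h
        · subst h; omega
        · omega
      · intro z
        rw [hs]
        unfold Conf
        by_cases h1 : z = u
        · subst h1; simp [huv]; omega
        · by_cases h2 : z = v
          · subst h2; simp [h1]; omega
          · simp [h1, h2]; omega
      · rw [hs]; simp [huv]
      · intro z; rw [hs]; ring
    · set D' := D - Pi.single s(u, v) 1 with hD'
      have hdD' : ∀ z, degZ G (-D') z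
          = - (degZ G D z - ((if z = u then 1 else 0) + (if z = v then 1 else 0))) := by
        intro z; rw [degZ_neg, hD', degZ_sub, hs]
      have hlt : ∑ e, ((-D') e).natAbs < ∑ e, (D e).natAbs := by
        refine Finset.sum_lt_sum ?_ ⟨s(u, v), Finset.mem_univ _, ?_⟩
        · intro e' _
          simp only [hD', Pi.neg_apply, Pi.sub_apply, hse]
          split_ifs with h
          · subst h; omega
          · omega
        · simp only [hD', Pi.neg_apply, Pi.sub_apply, hse]
          simp only [if_true]
          omega
      obtain ⟨f, v', s, hs1, hfe, hfd, hfv, hf⟩ := ih (-D') (by omega) v (by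
        rw [hdD']; simp [huv.symm]; omega)
      refine ⟨Pi.single s(u, v) 1 - f, v', -s, by omega, ?_, ?_, ?_, ?_⟩
      · intro e'
        have := hfe e'
        simp only [hD', Pi.neg_apply, Pi.sub_apply, hse] at this ⊢
        unfold Conf at this ⊢
        split_ifs at this ⊢ with h
        · subst h; omega
        · omega
      · intro z
        have := hfd z
        rw [hdD'] at this
        rw [degZ_sub, hs]
        unfold Conf at this ⊢
        by_cases h1 : z = u
        · subst h1; simp [huv] at this ⊢; omega
        · by_cases h2 : z = v
          · subst h2; simp [h1] at this ⊢; omega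
          · simp [h1, h2] at this ⊢; omega
      · have := hfd u
        rw [hdD'] at this
        rw [degZ_sub, hs]
        unfold Conf at this
        simp [huv] at this ⊢; omega
      · intro z
        rw [degZ_sub, hs, hf]; ring

lemma augment (n : ℕ) : ∀ (D : Sym2 V → ℤ), ∑ e, (D e).natAbs ≤ n → 0 < cardZ G D →
    ∃ (f : Sym2 V → ℤ), (∀ e, Conf (f e) (D e)) ∧
      (∀ z, Conf (degZ G f z) (degZ G D z)) ∧ cardZ G f = 1 ∧ ∀ z, degZ G f z ≤ 2 := by
  induction n with
  | zero =>
    intro D hD hu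
    have : ∀ e, D e = 0 := by
      intro e
      have := Finset.single_le_sum (f := fun e => (D e).natAbs) (fun _ _ => Nat.zero_le _)
        (Finset.mem_univ e)
      omega
    simp [cardZ, this] at hu
  | succ n ih =>
    intro D hD hc
    obtain ⟨u, -, hu⟩ := Finset.exists_lt_of_sum_lt (s := Finset.univ) (f := fun _ => (0:ℤ))
      (g := degZ G D) (by rw [handshake]; simpa using hc)
    obtain ⟨f, v, s, hs, hfe, hfd, hfu, hf⟩ := exch G _ D le_rfl u hu
    have hcard : 2 * cardZ G f = 1 + s := by
      rw [← handshake]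
      simp_rw [hf]
      rw [Finset.sum_add_distrib, ← Finset.mul_sum]
      simp
    rcases hs with rfl | rfl
    · refine ⟨f, hfe, hfd, by omega, fun z => ?_⟩
      rw [hf]; split_ifs <;> omega
    · have hlt : ∑ e, ((D - f) e).natAbs < ∑ e, (D e).natAbs := by
        have hne : ∃ e, f e ≠ 0 := by
          by_contra! h
          simp [degZ, h] at hfu
        obtain ⟨e, he⟩ := hne
        refine Finset.sum_lt_sum ?_ ⟨e, Finset.mem_univ _, ?_⟩
        · intro e' _
          have := hfe e'
          unfold Conf at this
          simp only [Pi.sub_apply]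
          omega
        · have := hfe e
          unfold Conf at this
          simp only [Pi.sub_apply]
          omega
      obtain ⟨g, hge, hgd, hgc, hg2⟩ := ih (D - f) (by omega) (by rw [cardZ_sub]; omega)
      refine ⟨g, fun e => ?_, fun z => ?_, hgc, hg2⟩
      · have h1 := hfe e
        have h2 := hge e
        unfold Conf at *
        simp only [Pi.sub_apply] at h2
        omega
      · have h1 := hfd z
        have h2 := hgd z
        rw [degZ_sub] at h2
        unfold Conf at *
        omega

/-- integer version of a weight assignment -/
def toIntW (x : Sym2 V → ℕ) : Sym2 V → ℤ := fun e => (x e : ℤ)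

lemma degZ_toIntW (x : Sym2 V → ℕ) (v : V) : degZ G (toIntW x) v = (bmDeg G x v : ℤ) := by
  simp [degZ, toIntW, bmDeg]

lemma cardZ_toIntW (x : Sym2 V → ℕ) : cardZ G (toIntW x) = (bmCard G x : ℤ) := by
  simp [cardZ, toIntW, bmCard]

lemma card_bdd (b : V → ℕ) (x : Sym2 V → ℕ) (hx : IsBMatching G b x) :
    bmCard G x ≤ ∑ v, b v := by
  have h := handshake G (toIntW x)
  simp_rw [degZ_toIntW, cardZ_toIntW] at h
  have h2 : ∑ v, bmDeg G x v ≤ ∑ v, b v := Finset.sum_le_sum fun v _ => hx.2 v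
  have h3 : ∑ v, bmDeg G x v = 2 * bmCard G x := by exact_mod_cast h
  omega

lemma bdd (b : V → ℕ) : BddAbove {m | ∃ x, IsBMatching G b x ∧ bmCard G x = m} :=
  ⟨∑ v, b v, by rintro m ⟨x, hx, rfl⟩; exact card_bdd G b x hx⟩

lemma le_mu (b : V → ℕ) (w : V) (t : ℕ) (x : Sym2 V → ℕ)
    (hx : IsBMatching G (Function.update b w t) x) : bmCard G x ≤ mu G b w t :=
  le_csSup (bdd G _) ⟨x, hx, rfl⟩

lemma exists_mu (b : V → ℕ) (w : V) (t : ℕ) :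
    ∃ x, IsBMatching G (Function.update b w t) x ∧ bmCard G x = mu G b w t := by
  refine Nat.sSup_mem ?_ (bdd G (Function.update b w t))
  exact ⟨_, 0, ⟨fun _ _ => rfl, fun v => by simp [bmDeg]⟩, rfl⟩

/-- The condition away from `w`. -/
def Off (b : V → ℕ) (w : V) (x : Sym2 V → ℕ) : Prop :=
  (∀ e, e ∉ G.edgeSet → x e = 0) ∧ ∀ v, v ≠ w → bmDeg G x v ≤ b v

lemma isBM_iff (b : V → ℕ) (w : V) (t : ℕ) (x : Sym2 V → ℕ) :
    IsBMatching G (Function.update b w t) x ↔ Off G b w x ∧ bmDeg G x w ≤ t := by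
  constructor
  · rintro ⟨h1, h2⟩
    refine ⟨⟨h1, fun v hv => ?_⟩, ?_⟩
    · simpa [hv] using h2 v
    · simpa using h2 w
  · rintro ⟨⟨h1, h2⟩, h3⟩
    refine ⟨h1, fun v => ?_⟩
    by_cases hv : v = w
    · subst hv; simpa using h3
    · simpa [hv] using h2 v hv

lemma realize (b : V → ℕ) (w : V) (x y : Sym2 V → ℕ) (hx : Off G b w x) (hy : Off G b w y)
    (f : Sym2 V → ℤ) (hfe : ∀ e, Conf (f e) ((toIntW y - toIntW x) e))
    (hfd : ∀ z, Conf (degZ G f z) (degZ G (toIntW y - toIntW x) z)) :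
    ∃ x', Off G b w x' ∧ (bmCard G x' : ℤ) = bmCard G x + cardZ G f ∧
      (bmDeg G x' w : ℤ) = bmDeg G x w + degZ G f w := by
  have hz : toIntW (fun e => ((x e : ℤ) + f e).toNat) = toIntW x + f := by
    funext e
    have := hfe e
    simp only [Conf, toIntW, Pi.sub_apply, Pi.add_apply] at this ⊢
    omega
  have hd : ∀ v, (bmDeg G (fun e => ((x e : ℤ) + f e).toNat) v : ℤ)
      = bmDeg G x v + degZ G f v := by
    intro v
    rw [← degZ_toIntW, hz, degZ_add, degZ_toIntW]
  refine ⟨fun e => ((x e : ℤ) + f e).toNat, ⟨?_, ?_⟩, ?_, hd w⟩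
  · intro e he
    have h1 := hx.1 e he
    have h2 := hy.1 e he
    have := hfe e
    simp only [Conf, toIntW, Pi.sub_apply] at this ⊢
    omega
  · intro v hv
    have h1 := hx.2 v hv
    have h2 := hy.2 v hv
    have h3 := hfd v
    have h4 := hd v
    rw [degZ_sub, degZ_toIntW, degZ_toIntW] at h3
    unfold Conf at h3
    omega
  · rw [← cardZ_toIntW, hz, cardZ_add, cardZ_toIntW]

lemma one (b : V → ℕ) (w : V) (x y : Sym2 V → ℕ) (hx : Off G b w x) (hy : Off G b w y)
    (hc : bmCard G x + 1 ≤ bmCard G y) :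
    ∃ x', Off G b w x' ∧ bmCard G x' = bmCard G x + 1 ∧ bmDeg G x' w ≤ bmDeg G x w + 2 := by
  obtain ⟨f, hfe, hfd, hfc, hf2⟩ := augment G _ (toIntW y - toIntW x) le_rfl (by
    rw [cardZ_sub, cardZ_toIntW, cardZ_toIntW]; omega)
  obtain ⟨x', h1, h2, h3⟩ := realize G b w x y hx hy f hfe hfd
  have := hf2 w
  exact ⟨x', h1, by omega, by omega⟩

lemma two (b : V → ℕ) (w : V) (x y : Sym2 V → ℕ) (hx : Off G b w x) (hy : Off G b w y)
    (hc : bmCard G x + 2 ≤ bmCard G y) :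
    ∃ x₁ x₂, Off G b w x₁ ∧ bmCard G x₁ = bmCard G x + 1 ∧ bmDeg G x₁ w ≤ bmDeg G x w + 2 ∧
      Off G b w x₂ ∧ bmCard G x₂ = bmCard G x + 1 ∧ bmDeg G x₂ w ≤ bmDeg G x w + 2 ∧
      bmDeg G x₁ w + bmDeg G x₂ w ≤ bmDeg G x w + max (bmDeg G x w) (bmDeg G y w) := by
  obtain ⟨f, hfe, hfd, hfc, hf2⟩ := augment G _ (toIntW y - toIntW x) le_rfl (by
    rw [cardZ_sub, cardZ_toIntW, cardZ_toIntW]; omega)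
  obtain ⟨g, hge, hgd, hgc, hg2⟩ := augment G _ (toIntW y - toIntW x - f) le_rfl (by
    rw [cardZ_sub, cardZ_sub, cardZ_toIntW, cardZ_toIntW]; omega)
  obtain ⟨x₁, h1, h2, h3⟩ := realize G b w x y hx hy f hfe hfd
  obtain ⟨x₂, k1, k2, k3⟩ := realize G b w x y hx hy g
    (fun e => by
      have h1 := hfe e
      have h2 := hge e
      rw [Pi.sub_apply] at h2
      unfold Conf at *
      omega)
    (fun z => by
      have h1 := hfd z
      have h2 := hgd z
      rw [degZ_sub] at h2
      unfold Conf at *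
      omega)
  have a1 := hf2 w
  have a2 := hg2 w
  have a3 := hfd w
  have a4 := hgd w
  rw [degZ_sub] at a4
  rw [degZ_sub, degZ_toIntW, degZ_toIntW] at a3 a4
  unfold Conf at a3 a4
  exact ⟨x₁, x₂, h1, by omega, by omega, k1, by omega, by omega, by omega⟩

lemma mu_mono (b : V → ℕ) (w : V) {s t : ℕ} (h : s ≤ t) : mu G b w s ≤ mu G b w t := by
  obtain ⟨x, hx, hc⟩ := exists_mu G b w s
  rw [isBM_iff] at hx
  rw [← hc]
  exact le_mu G b w t x ((isBM_iff G b w t x).2 ⟨hx.1, hx.2.trans h⟩)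

lemma mu_lip (b : V → ℕ) (w : V) (t : ℕ) : mu G b w (t + 1) ≤ mu G b w t + 1 := by
  by_contra! hlt
  obtain ⟨x, hx, hxc⟩ := exists_mu G b w t
  obtain ⟨y, hy, hyc⟩ := exists_mu G b w (t + 1)
  rw [isBM_iff] at hx hy
  obtain ⟨x₁, x₂, h1, h2, h3, k1, k2, k3, h⟩ := two G b w x y hx.1 hy.1 (by omega)
  have key : ∀ z, Off G b w z → bmCard G z = bmCard G x + 1 → t + 1 ≤ bmDeg G z w := by
    intro z hz hc
    by_contra! hlt'
    have := le_mu G b w t z ((isBM_iff G b w t z).2 ⟨hz, by omega⟩)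
    omega
  have := key x₁ h1 h2
  have := key x₂ k1 k2
  omega

lemma mu_stable (b : V → ℕ) (w : V) (t : ℕ) (h : mu G b w (t + 2) = mu G b w t) (s : ℕ)
    (hs : t ≤ s) : mu G b w s = mu G b w t := by
  refine le_antisymm ?_ (mu_mono G b w hs)
  by_contra! hlt
  obtain ⟨x, hx, hxc⟩ := exists_mu G b w t
  obtain ⟨y, hy, hyc⟩ := exists_mu G b w s
  rw [isBM_iff] at hx hy
  obtain ⟨z, h1, h2, h3⟩ := one G b w x y hx.1 hy.1 (by omega)
  have := le_mu G b w (t + 2) z ((isBM_iff G b w _ z).2 ⟨h1, by omega⟩)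
  omega

lemma mu_no11 (b : V → ℕ) (w : V) (t : ℕ) (h : mu G b w (t + 1) = mu G b w t) :
    mu G b w (t + 3) ≤ mu G b w t + 1 := by
  by_contra! hlt
  obtain ⟨x, hx, hxc⟩ := exists_mu G b w t
  obtain ⟨y, hy, hyc⟩ := exists_mu G b w (t + 3)
  rw [isBM_iff] at hx hy
  obtain ⟨x₁, x₂, h1, h2, h3, k1, k2, k3, h⟩ := two G b w x y hx.1 hy.1 (by omega)
  have key : ∀ z, Off G b w z → bmCard G z = bmCard G x + 1 → t + 2 ≤ bmDeg G z w := by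
    intro z hz hc
    by_contra! hlt'
    have := le_mu G b w (t + 1) z ((isBM_iff G b w _ z).2 ⟨hz, by omega⟩)
    omega
  have := key x₁ h1 h2
  have := key x₂ k1 k2
  omega

lemma mu_lip' (b : V → ℕ) (w : V) (t k : ℕ) : mu G b w (t + k) ≤ mu G b w t + k := by
  induction k with
  | zero => simp
  | succ k ih => have := mu_lip G b w (t + k); rw [← add_assoc]; omega

end aux

/-- Let `t_max` be the least `t₀` with `μ(t) = μ(t₀)` for all `t ≥ t₀`, `c₁` the
largest `t` with `μ(t) = μ(0) + t`, and `c₂ = (t_max − c₁)/2`. If `t ≤ c₁`, or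
`t = c₁ + 2j` for some `j ≤ c₂`, then every maximum-cardinality `b`-matching `x`
of `G` with the capacity of `w` set to `t` saturates `w`: `deg_x(w) = t`. -/
theorem saturated_at_breakpoints {V : Type*} [Fintype V] (G : SimpleGraph V) (b : V → ℕ)
    (w : V) (tmax c₁ c₂ : ℕ)
    (htmax : ∀ t : ℕ, tmax ≤ t → mu G b w t = mu G b w tmax)
    (htmax_least : ∀ t₀ : ℕ, (∀ t : ℕ, t₀ ≤ t → mu G b w t = mu G b w t₀) → tmax ≤ t₀)
    (hc₁ : mu G b w c₁ = mu G b w 0 + c₁)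
    (hc₁_max : ∀ t : ℕ, mu G b w t = mu G b w 0 + t → t ≤ c₁)
    (hc₂ : c₂ = (tmax - c₁) / 2)
    (t : ℕ) (ht : t ≤ c₁ ∨ ∃ j : ℕ, j ≤ c₂ ∧ t = c₁ + 2 * j)
    (x : Sym2 V → ℕ) (hx : IsBMatching G (Function.update b w t) x)
    (hxmax : bmCard G x = mu G b w t) :
    bmDeg G x w = t := by
  by_contra hne
  have hx' := (isBM_iff G b w t x).1 hx
  have hlt : bmDeg G x w < t := lt_of_le_of_ne hx'.2 hne
  obtain ⟨t', rfl⟩ : ∃ t', t = t' + 1 := ⟨t - 1, by omega⟩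
  have heq : mu G b w (t' + 1) ≤ mu G b w t' := by
    rw [← hxmax]
    exact le_mu G b w t' x ((isBM_iff G b w t' x).2 ⟨hx'.1, by omega⟩)
  have hcase1 : ∀ s, s + 1 ≤ c₁ → mu G b w s < mu G b w (s + 1) := by
    intro s hs
    obtain ⟨k, rfl⟩ := Nat.exists_eq_add_of_le hs
    have h1 := mu_lip' G b w (s + 1) k
    have h2 := mu_lip' G b w 0 s
    rw [zero_add] at h2
    omega
  rcases ht with ht | ⟨j, hj, ht⟩
  · have := hcase1 t' ht
    omega
  · have main : ∀ i, i ≤ c₂ → mu G b w (c₁ + 2 * i + 1) = mu G b w (c₁ + 2 * i) ∧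
        (∀ s, s + 1 = c₁ + 2 * i → mu G b w s < mu G b w (s + 1)) := by
      intro i
      induction i with
      | zero =>
        intro _
        refine ⟨?_, fun s hs => hcase1 s (by omega)⟩
        have h1 := mu_lip G b w c₁
        have h2 := mu_mono G b w (Nat.le_succ c₁)
        have h3 : mu G b w (c₁ + 1) ≠ mu G b w 0 + (c₁ + 1) := by
          intro h
          have := hc₁_max _ h
          omega
        simp only [Nat.succ_eq_add_one] at h2
        simp only [mul_zero, add_zero]
        omega
      | succ i ih =>
        intro hi
        obtain ⟨h1, -⟩ := ih (by omega)
        have h2 : mu G b w (c₁ + 2 * i + 2) ≠ mu G b w (c₁ + 2 * i) := by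
          intro h
          have := htmax_least _ (mu_stable G b w _ h)
          omega
        have h3 := mu_no11 G b w _ h1
        have h4 := mu_mono G b w (show c₁ + 2 * i ≤ c₁ + 2 * i + 2 by omega)
        have h5 := mu_mono G b w (show c₁ + 2 * i + 2 ≤ c₁ + 2 * i + 3 by omega)
        refine ⟨?_, fun s hs => ?_⟩
        · rw [show c₁ + 2 * (i + 1) + 1 = c₁ + 2 * i + 3 by ring,
            show c₁ + 2 * (i + 1) = c₁ + 2 * i + 2 by ring]
          omega
        · obtain rfl : s = c₁ + 2 * i + 1 := by omega
          rw [show c₁ + 2 * i + 1 + 1 = c₁ + 2 * i + 2 by ring]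
          omega
    have := (main j hj).2 t' ht
    omega
end
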